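/- Let k ≥ 2 and let f : 𝔽₂^k → 𝔽₂ be EA-equivalent to the monomial x ↦ x₁x₂, i.e., f(x) = (π(x))₁ · (π(x))₂ ⊕ h(x) for some affine bijection π : 𝔽₂^k → 𝔽₂^k and some affine function h : 𝔽₂^k → 𝔽₂. Then the Walsh transform W_f vanishes except at exactly four points, these four points form a coset of a 2-dimensional linear subspace of 𝔽₂^k, at each of these points W_f takes the value +2^{k−1} or −2^{k−1}, and the number of these points where W_f = +2^{k−1} is odd. -/

import Mathlib

/-- `𝔽₂ⁿ`, the space of binary vectors of length `n`. -/
abbrev BV (n : ℕ) : Type := Fin n → ZMod 2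

/-- The inner product `⟨x, y⟩ = ⊕ᵢ xᵢ yᵢ` on `𝔽₂ⁿ`. -/
def ip {n : ℕ} (x y : BV n) : ZMod 2 := ∑ i, x i * y i

/-- The Walsh transform `W_f(y) = ∑_{x} (−1)^{f(x) ⊕ ⟨x,y⟩}` of a Boolean function. -/
def walsh {n : ℕ} (f : BV n → ZMod 2) (y : BV n) : ℤ :=
  ∑ x : BV n, (-1 : ℤ) ^ ((f x + ip x y).val)

/-- A Boolean function in `n` variables (`n` even) is bent if `|W_f(y)| = 2^{n/2}`
for all `y`. -/
def IsBent (n : ℕ) (f : BV n → ZMod 2) : Prop :=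
  ∀ y : BV n, |walsh f y| = 2 ^ (n / 2)

/-- `b_n`, the number of bent functions in `n` variables. -/
noncomputable def bentCount (n : ℕ) : ℕ :=
  Nat.card {f : BV n → ZMod 2 // IsBent n f}

/-- `S` is a coset of a 2-dimensional linear subspace of `𝔽₂^k`. -/
def IsCoset2 {k : ℕ} (S : Set (BV k)) : Prop :=
  ∃ W : Submodule (ZMod 2) (BV k), Module.finrank (ZMod 2) W = 2 ∧
    ∃ a : BV k, S = {v | ∃ w ∈ W, v = a + w}

theorem neg_one_pow_val_add (z w : ZMod 2) :
    (-1 : ℤ) ^ (z + w).val = (-1) ^ z.val * (-1) ^ w.val := by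
  revert z w; decide

theorem two_mul_neg_one_pow_val_mul (s t : ZMod 2) :
    2 * (-1 : ℤ) ^ (s * t).val =
      1 + (-1) ^ s.val + (-1) ^ t.val - (-1) ^ s.val * (-1) ^ t.val := by
  revert s t; decide

theorem ZMod.two_eq_zero_or_one (z : ZMod 2) : z = 0 ∨ z = 1 := by
  revert z; decide

theorem ip_add_left {n : ℕ} (x y z : BV n) : ip (x + y) z = ip x z + ip y z := by
  simp [ip, add_mul, Finset.sum_add_distrib]

theorem ip_add_right {n : ℕ} (x y z : BV n) : ip x (y + z) = ip x y + ip x z := by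
  simp [ip, mul_add, Finset.sum_add_distrib]

theorem ip_comm {n : ℕ} (x y : BV n) : ip x y = ip y x := by
  simp [ip, mul_comm]

theorem BV.add_eq_zero_iff {n : ℕ} {x y : BV n} : x + y = 0 ↔ y = x := by
  rw [add_eq_zero_iff_eq_neg, ZModModule.neg_eq_self, eq_comm]

/-- Orthogonality of the characters of `𝔽₂ⁿ`. -/
theorem sum_neg_one_pow_ip {n : ℕ} (w : BV n) :
    ∑ x : BV n, (-1 : ℤ) ^ (ip w x).val = if w = 0 then 2 ^ n else 0 := by
  split_ifs with h
  · subst h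
    simp [ip]
  · obtain ⟨i, hi⟩ := Function.ne_iff.mp h
    have hi : w i = 1 := (ZMod.two_eq_zero_or_one _).resolve_left hi
    have hs : ip w (Pi.single i 1) = 1 := by simp [ip, Pi.single_apply, hi]
    have key : ∑ x : BV n, (-1 : ℤ) ^ (ip w (x + Pi.single i 1)).val =
        ∑ x : BV n, (-1 : ℤ) ^ (ip w x).val :=
      Equiv.sum_comp (Equiv.addRight (Pi.single i 1 : BV n)) fun x => (-1 : ℤ) ^ (ip w x).val
    have neg (x : BV n) : (-1 : ℤ) ^ (ip w (x + Pi.single i 1)).val = -(-1) ^ (ip w x).val := by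
      rw [ip_add_right, hs, neg_one_pow_val_add, ZMod.val_one, pow_one, mul_neg_one]
    rw [Finset.sum_congr rfl fun x _ => neg x, Finset.sum_neg_distrib] at key
    exact self_eq_neg.mp key.symm

/-- The Walsh transform of a product of two affine functions plus an affine function. -/
theorem walsh_mul_add {n : ℕ} (hn : n ≠ 0) (u v a : BV n) (p q c : ZMod 2) (y : BV n) :
    walsh (fun x => (ip u x + p) * (ip v x + q) + (ip a x + c)) y =
      2 ^ (n - 1) * ((-1) ^ c.val *
        ((if y = a then 1 else 0) + (-1) ^ p.val * (if y = a + u then 1 else 0)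
          + (-1) ^ q.val * (if y = a + v then 1 else 0)
          - (-1) ^ p.val * (-1) ^ q.val * (if y = a + (u + v) then 1 else 0))) := by
  have expand (x : BV n) :
      2 * (-1 : ℤ) ^ ((ip u x + p) * (ip v x + q) + (ip a x + c) + ip x y).val =
        (-1) ^ c.val * ((-1) ^ (ip (a + y) x).val
          + (-1) ^ p.val * (-1) ^ (ip (a + u + y) x).val
          + (-1) ^ q.val * (-1) ^ (ip (a + v + y) x).val
          - (-1) ^ p.val * (-1) ^ q.val * (-1) ^ (ip (a + (u + v) + y) x).val) := by
    rw [neg_one_pow_val_add, neg_one_pow_val_add, ← mul_assoc, ← mul_assoc,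
      two_mul_neg_one_pow_val_mul, ip_comm x y]
    simp only [ip_add_left, neg_one_pow_val_add]
    ring
  have hpow : (2 : ℤ) ^ n = 2 * 2 ^ (n - 1) := by
    rw [← pow_succ', Nat.sub_add_cancel (Nat.pos_of_ne_zero hn)]
  apply mul_left_cancel₀ (two_ne_zero' ℤ)
  rw [walsh, Finset.mul_sum, Finset.sum_congr rfl fun x _ => expand x, ← Finset.mul_sum,
    Finset.sum_sub_distrib, Finset.sum_add_distrib, Finset.sum_add_distrib]
  simp only [← Finset.mul_sum, sum_neg_one_pow_ip, BV.add_eq_zero_iff, hpow]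
  split_ifs <;> ring

theorem LinearMap.exists_eq_ip {n : ℕ} (φ : BV n →ₗ[ZMod 2] ZMod 2) :
    ∃ u : BV n, ∀ x, φ x = ip u x := by
  refine ⟨fun i => φ (Pi.single i 1), fun x => ?_⟩
  rw [LinearMap.pi_apply_eq_sum_univ φ x, ip]
  refine Finset.sum_congr rfl fun i _ => ?_
  rw [smul_eq_mul, mul_comm]
  congr 2
  ext j
  simp [Pi.single_apply, eq_comm]

theorem BV.mem_span_pair {n : ℕ} {u v w : BV n} :
    w ∈ Submodule.span (ZMod 2) {u, v} ↔ w = 0 ∨ w = u ∨ w = v ∨ w = u + v := by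
  rw [Submodule.mem_span_pair]
  constructor
  · rintro ⟨s, t, rfl⟩
    rcases ZMod.two_eq_zero_or_one s with rfl | rfl <;>
      rcases ZMod.two_eq_zero_or_one t with rfl | rfl <;> simp
  · rintro (rfl | rfl | rfl | rfl)
    · exact ⟨0, 0, by simp⟩
    · exact ⟨1, 0, by simp⟩
    · exact ⟨0, 1, by simp⟩
    · exact ⟨1, 1, by simp⟩

theorem isCoset2_of_ne {n : ℕ} {u v : BV n} (a : BV n) (hu : u ≠ 0) (hv : v ≠ 0) (huv : u ≠ v) :
    IsCoset2 ({a, a + u, a + v, a + (u + v)} : Set (BV n)) := by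
  refine ⟨Submodule.span (ZMod 2) {u, v}, ?_, a, ?_⟩
  · have hli : LinearIndependent (ZMod 2) ![u, v] := by
      rw [LinearIndependent.pair_iff]
      intro s t h
      rcases ZMod.two_eq_zero_or_one s with rfl | rfl <;>
        rcases ZMod.two_eq_zero_or_one t with rfl | rfl <;>
        simp_all [BV.add_eq_zero_iff, eq_comm]
    rw [← Matrix.range_cons_cons_empty u v ![], finrank_span_eq_card hli, Fintype.card_fin]
  · ext y
    simp [BV.mem_span_pair]

/-- if `f : 𝔽₂^k → 𝔽₂` (`k ≥ 2`) is EA-equivalent to the monomial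
`x ↦ x₁x₂`, i.e. `f(x) = (π x)₁ (π x)₂ ⊕ h(x)` with `π` an affine bijection and
`h` affine, then `W_f` vanishes outside a set `S` which is a coset of a
2-dimensional linear subspace, takes the values `±2^{k−1}` on `S`, and the
number of points of `S` where `W_f = +2^{k−1}` is odd. -/
theorem stmt_11 (k : ℕ) (hk : 2 ≤ k) (f : BV k → ZMod 2)
    (L : BV k ≃ₗ[ZMod 2] BV k) (b : BV k) (a : BV k) (c : ZMod 2)
    (hf : ∀ x, f x = (L x + b) ⟨0, by omega⟩ * (L x + b) ⟨1, by omega⟩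
                      + (ip a x + c)) :
    ∃ S : Set (BV k), IsCoset2 S ∧ {y | walsh f y ≠ 0} = S ∧
      (∀ y ∈ S, walsh f y = 2 ^ (k - 1) ∨ walsh f y = -(2 ^ (k - 1))) ∧
      Odd (Nat.card {y : BV k // y ∈ S ∧ walsh f y = 2 ^ (k - 1)}) := by
  obtain ⟨u, hu⟩ := LinearMap.exists_eq_ip
    (LinearMap.proj (⟨0, by omega⟩ : Fin k) ∘ₗ L.toLinearMap)
  obtain ⟨v, hv⟩ := LinearMap.exists_eq_ip
    (LinearMap.proj (⟨1, by omega⟩ : Fin k) ∘ₗ L.toLinearMap)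
  simp only [LinearMap.comp_apply, LinearMap.proj_apply, LinearEquiv.coe_coe] at hu hv
  have hu1 : ip u (L.symm (Pi.single ⟨0, by omega⟩ 1)) = 1 := by simp [← hu]
  have hv0 : ip v (L.symm (Pi.single ⟨0, by omega⟩ 1)) = 0 := by simp [← hv]
  have hv1 : ip v (L.symm (Pi.single ⟨1, by omega⟩ 1)) = 1 := by simp [← hv]
  have hune : u ≠ 0 := by rintro rfl; simp [ip] at hu1
  have hvne : v ≠ 0 := by rintro rfl; simp [ip] at hv1
  have huv : u ≠ v := by rintro rfl; simp [hu1] at hv0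
  have hW (y : BV k) := walsh_mul_add (by omega) u v a (b ⟨0, by omega⟩) (b ⟨1, by omega⟩) c y
  have hfun : f = fun x => (ip u x + b ⟨0, by omega⟩) * (ip v x + b ⟨1, by omega⟩)
      + (ip a x + c) := by
    funext x
    rw [hf, ← hu, ← hv]
    rfl
  rw [← hfun] at hW
  have huv0 : u + v ≠ 0 := fun h => huv (BV.add_eq_zero_iff.mp h).symm
  generalize (b ⟨0, _⟩ : ZMod 2) = p at hW
  generalize (b ⟨1, _⟩ : ZMod 2) = q at hW
  have h0 : walsh f a = 2 ^ (k - 1) * (-1) ^ c.val := by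
    rw [hW]; simp [hune, hvne, huv0]
  have h1 : walsh f (a + u) = 2 ^ (k - 1) * (-1) ^ (c + p).val := by
    rw [hW, neg_one_pow_val_add]; simp [hune, hvne, huv]
  have h2 : walsh f (a + v) = 2 ^ (k - 1) * (-1) ^ (c + q).val := by
    rw [hW, neg_one_pow_val_add]; simp [hune, hvne, huv.symm]
  have h3 : walsh f (a + (u + v)) = 2 ^ (k - 1) * (-1) ^ (c + p + q + 1).val := by
    rw [hW]; simp [hune, hvne, huv0, neg_one_pow_val_add, ZMod.val_one, mul_assoc]
  have hpow : (2 : ℤ) ^ (k - 1) ≠ 0 := by positivity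
  have hval (z : ZMod 2) : (2 : ℤ) ^ (k - 1) * (-1) ^ z.val = 2 ^ (k - 1) ↔ z = 0 := by
    rw [mul_eq_left₀ hpow]
    revert z; decide
  have hmem (y : BV k) (hy : y ∈ ({a, a + u, a + v, a + (u + v)} : Set (BV k))) :
      walsh f y = 2 ^ (k - 1) ∨ walsh f y = -(2 ^ (k - 1)) := by
    have hsign (z : ZMod 2) : (2 : ℤ) ^ (k - 1) * (-1) ^ z.val = 2 ^ (k - 1) ∨
        (2 : ℤ) ^ (k - 1) * (-1) ^ z.val = -(2 ^ (k - 1)) := by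
      rcases neg_one_pow_eq_or ℤ z.val with h | h <;> simp [h]
    rcases hy with rfl | rfl | rfl | rfl
    · rw [h0]; exact hsign _
    · rw [h1]; exact hsign _
    · rw [h2]; exact hsign _
    · rw [h3]; exact hsign _
  refine ⟨{a, a + u, a + v, a + (u + v)}, isCoset2_of_ne a hune hvne huv, ?_, hmem, ?_⟩
  · ext y
    refine ⟨fun hy => ?_, fun hy => ?_⟩
    · by_contra hS
      simp only [Set.mem_insert_iff, Set.mem_singleton_iff, not_or] at hS
      exact hy (by simp [hW, hS])
    · rcases hmem y hy with h | h <;> simp [h]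
  · have hcard : Nat.card {y : BV k // y ∈ ({a, a + u, a + v, a + (u + v)} : Set (BV k)) ∧
        walsh f y = 2 ^ (k - 1)} = Finset.card (({a, a + u, a + v, a + (u + v)} :
          Finset (BV k)).filter fun y => walsh f y = 2 ^ (k - 1)) :=
      Nat.subtype_card _ (by simp)
    rw [hcard, Finset.card_filter, Finset.sum_insert (by simp [hune, hvne, huv0]),
      Finset.sum_insert (by simp [hvne, huv]), Finset.sum_insert (by simp [hune]),
      Finset.sum_singleton]
    simp only [h0, h1, h2, h3, hval]
    clear * -
    revert p q c; decide
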